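/- Let α > 1 and let τ(ξ) = 2(1+α)·S(ρξ) be the function defined from the WKB integral S. Then, with A = (1+α)·(Γ(1/(2α))/(√(πα)·Γ((1+α)/(2α))))^{2α/(α+1)}: τ(ξ) = (Aξ)^{(1+α)/(2α)} − (1+α) + O(ξ^{−(1+α)/(2α)}) as ξ → +∞; and for every n ≥ 1, Dⁿτ(ξ) = ((1+α)/(2α))ⁿ·(Aξ)^{(1+α)/(2α)} + O(ξ^{−(1+α)/(2α)}) as ξ → +∞. -/

import Mathlib

open Real MeasureTheory Set Filter Topology Asymptotics

noncomputable section

/-- The Euler operator D = x d/dx. -/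
def eulerD (f : ℝ → ℝ) : ℝ → ℝ := fun x => x * deriv f x

/-- V(u;x) = x u² − u^{2α+2} − 1. -/
def Vfun (α x u : ℝ) : ℝ := x * u ^ 2 - u ^ (2 * α + 2) - 1

/-- ρ = ((α+1)/α)·α^{1/(α+1)}. -/
def rhoC (α : ℝ) : ℝ := ((α + 1) / α) * α ^ (1 / (α + 1))

/-- The smaller positive root u₁(x) of V(·;x). -/
def u1F (α x : ℝ) : ℝ := sInf {u : ℝ | 0 < u ∧ Vfun α x u = 0}

/-- The larger positive root u₂(x) of V(·;x). -/
def u2F (α x : ℝ) : ℝ := sSup {u : ℝ | 0 < u ∧ Vfun α x u = 0}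

/-- The WKB integral S(x). -/
def Sfun (α x : ℝ) : ℝ :=
  if rhoC α < x then (1/π) * ∫ u in u1F α x..u2F α x, Real.sqrt (Vfun α x u) / u else 0

/-- τ(ξ) = 2(1+α)·S(ρξ). -/
def tauF (α ξ : ℝ) : ℝ := 2 * (1 + α) * Sfun α (rhoC α * ξ)

/-- The constant A. -/
def Aconst (α : ℝ) : ℝ :=
  (1 + α) * (Real.Gamma (1 / (2 * α)) /
    (Real.sqrt (π * α) * Real.Gamma ((1 + α) / (2 * α)))) ^ (2 * α / (α + 1))

lemma hasDerivAt_two_mul_sqrt_sub_arctan {r : ℝ} (hr : 1 < r) :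
    HasDerivAt (fun r : ℝ => 2 * √(r - 1) - 2 * arctan √(r - 1)) (√(r - 1) / r) r := by
  have h0 : 0 < r - 1 := by linarith
  have h1 : HasDerivAt (fun r : ℝ => √(r - 1)) (1 / (2 * √(r - 1))) r :=
    ((hasDerivAt_id r).sub_const 1).sqrt h0.ne'
  refine ((h1.const_mul 2).sub (h1.arctan.const_mul 2)).congr_deriv ?_
  have h3 := Real.sq_sqrt h0.le
  have h4 : √(r - 1) ≠ 0 := (Real.sqrt_pos.2 h0).ne'
  rw [h3]
  have : 1 + (r - 1) ≠ 0 := by linarith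
  field_simp
  linear_combination (-r) * h3

/-- The regularised square root `√(r - 1)₊ - √r`. -/
def sqrtGap (r : ℝ) : ℝ := √(r - 1) - √r

/-- The primitive of `sqrtGap r / r` that vanishes at `0`. -/
def sqrtGapPrimitive (r : ℝ) : ℝ := 2 * √(r - 1) - 2 * arctan √(r - 1) - 2 * √r

lemma continuous_sqrtGap : Continuous sqrtGap := by unfold sqrtGap; fun_prop

lemma continuous_sqrtGapPrimitive : Continuous sqrtGapPrimitive := by
  unfold sqrtGapPrimitive
  have := continuous_arctan
  fun_prop

lemma sqrtGapPrimitive_zero : sqrtGapPrimitive 0 = 0 := by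
  simp [sqrtGapPrimitive, Real.sqrt_eq_zero_of_nonpos]

lemma sqrtGap_nonpos (r : ℝ) : sqrtGap r ≤ 0 :=
  sub_nonpos.2 (Real.sqrt_le_sqrt (by linarith))

lemma abs_sqrtGap_le_sqrt (r : ℝ) : |sqrtGap r| ≤ √r := by
  rw [abs_of_nonpos (sqrtGap_nonpos r), sqrtGap]
  linarith [Real.sqrt_nonneg (r - 1)]

lemma abs_sqrtGap_mul_sqrt_le_one (r : ℝ) : |sqrtGap r| * √r ≤ 1 := by
  rw [abs_of_nonpos (sqrtGap_nonpos r), sqrtGap]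
  rcases le_total r 1 with h | h
  · rw [Real.sqrt_eq_zero_of_nonpos (by linarith : r - 1 ≤ 0)]
    have := Real.sqrt_le_one.2 h
    nlinarith [Real.sqrt_nonneg r]
  · have h1 := Real.sq_sqrt (by linarith : 0 ≤ r - 1)
    have h2 := Real.sq_sqrt (by linarith : 0 ≤ r)
    have h3 := Real.sqrt_nonneg (r - 1)
    have h4 : √(r - 1) ≤ √r := Real.sqrt_le_sqrt (by linarith)
    nlinarith

lemma abs_sqrtGap_le_one (r : ℝ) : |sqrtGap r| ≤ 1 := by
  rcases le_total r 1 with h | h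
  · exact (abs_sqrtGap_le_sqrt r).trans (Real.sqrt_le_one.2 h)
  · have h1 := abs_sqrtGap_mul_sqrt_le_one r
    have h2 := Real.one_le_sqrt.2 h
    nlinarith [abs_nonneg (sqrtGap r)]

lemma hasDerivAt_sqrtGapPrimitive {r : ℝ} (hr : 0 < r) :
    HasDerivAt sqrtGapPrimitive (sqrtGap r / r) r := by
  have key : HasDerivAt (fun r : ℝ => 2 * √(r - 1) - 2 * arctan √(r - 1)) (√(r - 1) / r) r := by
    rcases eq_or_ne r 1 with rfl | h1
    · refine hasDerivAt_of_hasDerivAt_of_ne (g := fun r => √(r - 1) / r) (fun y hy => ?_) ?_ ?_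
      · rcases lt_or_gt_of_ne hy with h | h
        · have : (fun r : ℝ => 2 * √(r - 1) - 2 * arctan √(r - 1)) =ᶠ[𝓝 y] fun _ => 0 := by
            filter_upwards [Iio_mem_nhds h] with z hz
            simp [Real.sqrt_eq_zero_of_nonpos (sub_nonpos.2 (le_of_lt hz))]
          rw [Real.sqrt_eq_zero_of_nonpos (by linarith : y - 1 ≤ 0), zero_div]
          exact (hasDerivAt_const y (0 : ℝ)).congr_of_eventuallyEq this
        · exact hasDerivAt_two_mul_sqrt_sub_arctan h
      · have := continuous_arctan
        fun_prop
      · exact ContinuousAt.div (by fun_prop) (by fun_prop) one_ne_zero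
    · rcases lt_or_gt_of_ne h1 with h | h
      · have : (fun r : ℝ => 2 * √(r - 1) - 2 * arctan √(r - 1)) =ᶠ[𝓝 r] fun _ => 0 := by
          filter_upwards [Iio_mem_nhds h] with z hz
          simp [Real.sqrt_eq_zero_of_nonpos (sub_nonpos.2 (le_of_lt hz))]
        rw [Real.sqrt_eq_zero_of_nonpos (by linarith : r - 1 ≤ 0), zero_div]
        exact (hasDerivAt_const r (0 : ℝ)).congr_of_eventuallyEq this
      · exact hasDerivAt_two_mul_sqrt_sub_arctan h
  have h2 := (Real.hasDerivAt_sqrt hr.ne').const_mul 2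
  refine (key.sub h2).congr_deriv ?_
  have h3 := Real.sq_sqrt hr.le
  have h4 : √r ≠ 0 := (Real.sqrt_pos.2 hr).ne'
  rw [sqrtGap]
  field_simp
  linear_combination h3

/-- The limit `-π` of `sqrtGapPrimitive` at infinity is approached at rate `r ^ (-1/2)`. -/
lemma abs_sqrtGapPrimitive_add_pi_mul_sqrt_le (r : ℝ) :
    |sqrtGapPrimitive r + π| * √r ≤ 2 + 2 * π := by
  have hpi := Real.pi_pos
  have e : sqrtGapPrimitive r + π = 2 * sqrtGap r + 2 * (π / 2 - arctan √(r - 1)) := by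
    rw [sqrtGapPrimitive, sqrtGap]; ring
  have ha : 0 ≤ π / 2 - arctan √(r - 1) := by linarith [arctan_lt_pi_div_two √(r - 1)]
  have hb : (π / 2 - arctan √(r - 1)) * √r ≤ π := by
    have h0 : 0 ≤ arctan √(r - 1) := arctan_nonneg.2 (Real.sqrt_nonneg _)
    rcases le_total r 2 with h | h
    · have : √r ≤ 2 := by rw [Real.sqrt_le_left (by norm_num)]; linarith
      nlinarith [Real.sqrt_nonneg r]
    · have h1 : 0 < √(r - 1) := Real.sqrt_pos.2 (by linarith)
      rw [← arctan_inv_of_pos h1]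
      have h2 : arctan (√(r - 1))⁻¹ ≤ (√(r - 1))⁻¹ := by
        simpa using le_tan (arctan_nonneg.2 (inv_pos.2 h1).le) (arctan_lt_pi_div_two (√(r - 1))⁻¹)
      have h3 : √r ≤ 2 * √(r - 1) := by
        rw [Real.sqrt_le_left (by positivity), mul_pow, Real.sq_sqrt (by linarith)]
        linarith
      calc arctan (√(r - 1))⁻¹ * √r ≤ (√(r - 1))⁻¹ * (2 * √(r - 1)) := by gcongr
        _ = 2 := by field_simp
        _ ≤ π := by linarith [Real.pi_gt_three]
  rw [e]
  calc |2 * sqrtGap r + 2 * (π / 2 - arctan √(r - 1))| * √r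
      ≤ (2 * |sqrtGap r| + 2 * (π / 2 - arctan √(r - 1))) * √r := by
        gcongr
        refine (abs_add_le _ _).trans_eq ?_
        rw [abs_mul, abs_mul, abs_of_nonneg ha, abs_two]
    _ ≤ 2 + 2 * π := by linarith [abs_sqrtGap_mul_sqrt_le_one r]

/-- The rescaled potential `z ^ β * (1 - z)`, with `β = 1 / α`. -/
def potential (β z : ℝ) : ℝ := z ^ β * (1 - z)

lemma continuous_potential {β : ℝ} (hβ : 0 < β) : Continuous (potential β) := by
  unfold potential
  exact (continuous_id.rpow_const fun _ => Or.inr hβ.le).mul (by fun_prop)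

lemma potential_zero {β : ℝ} (hβ : 0 < β) : potential β 0 = 0 := by
  simp [potential, Real.zero_rpow hβ.ne']

lemma potential_one (β : ℝ) : potential β 1 = 0 := by simp [potential]

lemma potential_pos {β z : ℝ} (h0 : 0 < z) (h1 : z < 1) : 0 < potential β z :=
  mul_pos (rpow_pos_of_pos h0 _) (by linarith)

lemma hasDerivAt_potential (β : ℝ) {z : ℝ} (hz : 0 < z) :
    HasDerivAt (potential β) (z ^ β * (β * (1 - z) - z) / z) z := by
  refine ((hasDerivAt_rpow_const (Or.inl hz.ne') (p := β)).mul
    ((hasDerivAt_id z).const_sub 1)).congr_deriv ?_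
  rw [rpow_sub_one hz.ne']
  simp only [id]
  field_simp
  ring

lemma intervalIntegrable_beta {a b : ℝ} (ha : 0 < a) (hb : 0 < b) :
    IntervalIntegrable (fun z : ℝ => z ^ (a - 1) * (1 - z) ^ (b - 1)) volume 0 1 := by
  have h := Complex.betaIntegral_convergent (u := a) (v := b) (by simpa) (by simpa)
  rw [intervalIntegrable_iff_integrableOn_Ioc_of_le zero_le_one] at h ⊢
  refine (IntegrableOn.congr_fun h.re (fun z hz => ?_) measurableSet_Ioc)
  have h1 : 0 ≤ 1 - z := by linarith [hz.2]
  change (_ : ℂ).re = _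
  norm_cast
  rw [← Complex.ofReal_cpow hz.1.le, ← Complex.ofReal_cpow h1, ← Complex.ofReal_mul,
    Complex.ofReal_re]

lemma integral_beta {a b : ℝ} (ha : 0 < a) (hb : 0 < b) :
    ∫ z in (0 : ℝ)..1, z ^ (a - 1) * (1 - z) ^ (b - 1) = ProbabilityTheory.beta a b := by
  rw [ProbabilityTheory.beta_eq_betaIntegralReal a b ha hb, Complex.betaIntegral,
    intervalIntegral.integral_of_le zero_le_one, intervalIntegral.integral_of_le zero_le_one,
    ← RCLike.re_to_complex, ← integral_re]
  · refine setIntegral_congr_fun measurableSet_Ioc fun z hz => ?_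
    have h1 : 0 ≤ 1 - z := by linarith [hz.2]
    norm_cast
    rw [← Complex.ofReal_cpow hz.1.le, ← Complex.ofReal_cpow h1, RCLike.re_to_complex,
      ← Complex.ofReal_mul, Complex.ofReal_re]
  · have h := Complex.betaIntegral_convergent (u := a) (v := b) (by simpa) (by simpa)
    rwa [intervalIntegrable_iff_integrableOn_Ioc_of_le zero_le_one] at h

lemma sqrt_potential_div {β z : ℝ} (h0 : 0 < z) :
    √(potential β z) / z = z ^ (β / 2 - 1) * (1 - z) ^ ((3 / 2 : ℝ) - 1) := by
  rw [potential, Real.sqrt_mul (by positivity), Real.sqrt_eq_rpow, Real.sqrt_eq_rpow,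
    ← rpow_mul h0.le, rpow_sub_one h0.ne']
  norm_num
  ring_nf

lemma intervalIntegrable_sqrt_potential_div {β : ℝ} (hβ : 0 < β) :
    IntervalIntegrable (fun z => √(potential β z) / z) volume 0 1 := by
  refine (intervalIntegrable_beta (a := β / 2) (b := 3 / 2) (by positivity)
    (by norm_num)).congr fun z hz => ?_
  rw [uIoc_of_le zero_le_one] at hz
  exact (sqrt_potential_div hz.1).symm

lemma integral_sqrt_potential_div {β : ℝ} (hβ : 0 < β) :
    ∫ z in (0 : ℝ)..1, √(potential β z) / z = ProbabilityTheory.beta (β / 2) (3 / 2) := by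
  rw [← integral_beta (a := β / 2) (b := 3 / 2) (by positivity) (by norm_num)]
  refine intervalIntegral.integral_congr_ae (Eventually.of_forall fun z hz => ?_)
  rw [uIoc_of_le zero_le_one] at hz
  exact sqrt_potential_div hz.1

lemma intervalIntegrable_inv_sqrt_potential {β : ℝ} (hβ : β < 2) :
    IntervalIntegrable (fun z => (√(potential β z))⁻¹) volume 0 1 := by
  refine (intervalIntegrable_beta (a := 1 - β / 2) (b := 1 / 2) (by linarith)
    (by norm_num)).congr fun z hz => ?_
  rw [uIoc_of_le zero_le_one] at hz
  have h0 := hz.1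
  rw [potential, Real.sqrt_mul (by positivity), Real.sqrt_eq_rpow, Real.sqrt_eq_rpow,
    ← rpow_mul h0.le, mul_inv, ← rpow_neg h0.le, ← rpow_neg (by linarith [hz.2])]
  norm_num
  left
  ring_nf

open scoped ContDiff

/-- Smooth weights vanishing near the critical point `β / (1 + β)` of the potential. -/
def IsWeight (β : ℝ) (W : ℝ → ℝ) : Prop :=
  ContDiff ℝ ∞ W ∧ ∀ᶠ z in 𝓝 (β / (1 + β)), W z = 0

/-- The weight divided by the logarithmic derivative of the potential. -/
def weightQuot (β : ℝ) (W : ℝ → ℝ) (z : ℝ) : ℝ := W z * ((1 - z) / (β - (1 + β) * z))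

/-- The operator on weights that corresponds to the Euler operator on `gapIntegral`. -/
def weightOp (β : ℝ) (W : ℝ → ℝ) (z : ℝ) : ℝ := z * deriv (weightQuot β W) z

/-- The difference between the integrals of `√(potential / ε - 1)₊` and `√(potential / ε)` with
respect to `W z dz / z`. -/
def gapIntegral (β : ℝ) (W : ℝ → ℝ) (ε : ℝ) : ℝ :=
  ∫ z in (0 : ℝ)..1, W z / z * sqrtGap (potential β z / ε)

lemma IsWeight.contDiff_quot {β : ℝ} (hβ : 0 < β) {W : ℝ → ℝ} (hW : IsWeight β W) :
    ContDiff ℝ ∞ (weightQuot β W) := by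
  rw [contDiff_iff_contDiffAt]
  intro z
  by_cases hz : z = β / (1 + β)
  · subst hz
    refine (contDiffAt_const (c := (0 : ℝ))).congr_of_eventuallyEq ?_
    filter_upwards [hW.2] with y hy
    simp [weightQuot, hy]
  · refine hW.1.contDiffAt.mul (ContDiffAt.div (by fun_prop) (by fun_prop) fun h => hz ?_)
    field_simp
    linarith

lemma IsWeight.quot_eventually {β : ℝ} {W : ℝ → ℝ} (hW : IsWeight β W) :
    weightQuot β W =ᶠ[𝓝 (β / (1 + β))] fun _ => 0 := by
  filter_upwards [hW.2] with y hy
  simp [weightQuot, hy]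

lemma IsWeight.contDiff_deriv_quot {β : ℝ} (hβ : 0 < β) {W : ℝ → ℝ} (hW : IsWeight β W) :
    ContDiff ℝ ∞ (deriv (weightQuot β W)) :=
  (contDiff_infty_iff_deriv.1 (hW.contDiff_quot hβ)).2

lemma IsWeight.weightOp {β : ℝ} (hβ : 0 < β) {W : ℝ → ℝ} (hW : IsWeight β W) :
    IsWeight β (weightOp β W) := by
  refine ⟨contDiff_id.mul (hW.contDiff_deriv_quot hβ), ?_⟩
  filter_upwards [hW.quot_eventually.deriv] with y hy
  simp [_root_.weightOp, hy]

lemma IsWeight.hasDerivAt_quot {β : ℝ} (hβ : 0 < β) {W : ℝ → ℝ} (hW : IsWeight β W) (z : ℝ) :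
    HasDerivAt (weightQuot β W) (deriv (weightQuot β W) z) z :=
  ((hW.contDiff_quot hβ).differentiable (by simp) z).hasDerivAt

lemma intervalIntegrable_gap {β : ℝ} (hβ : 0 < β) {W : ℝ → ℝ} (hW : Continuous W) {ε : ℝ}
    (hε : 0 < ε) :
    IntervalIntegrable (fun z => W z / z * sqrtGap (potential β z / ε)) volume 0 1 := by
  obtain ⟨C, hC⟩ := isCompact_Icc.exists_bound_of_continuousOn (hW.continuousOn (s := Icc 0 1))
  refine ((intervalIntegrable_sqrt_potential_div hβ).const_mul (C / √ε)).mono_fun' ?_ ?_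
  · have h1 := (continuous_sqrtGap.comp ((continuous_potential hβ).div_const ε)).measurable
    exact ((hW.measurable.div measurable_id).mul h1).aestronglyMeasurable
  · refine (ae_restrict_iff' measurableSet_uIoc).2 (Eventually.of_forall fun z hz => ?_)
    rw [uIoc_of_le zero_le_one] at hz
    have h0 := hz.1
    have h1 := abs_sqrtGap_le_sqrt (potential β z / ε)
    have h2 := hC z ⟨hz.1.le, hz.2⟩
    rw [Real.sqrt_div' _ hε.le] at h1
    simp only [Real.norm_eq_abs] at h2 ⊢
    rw [abs_mul, abs_div, abs_of_pos h0]
    have hC0 : 0 ≤ C := (abs_nonneg _).trans h2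
    calc |W z| / z * |sqrtGap (potential β z / ε)| ≤ C / z * (√(potential β z) / √ε) := by gcongr
      _ = C / √ε * (√(potential β z) / z) := by ring

/-- Integration by parts. -/
lemma gapIntegral_eq_neg_integral {β : ℝ} (hβ : 0 < β) {W : ℝ → ℝ} (hW : IsWeight β W) {ε : ℝ}
    (hε : 0 < ε) :
    gapIntegral β W ε = -∫ z in (0 : ℝ)..1,
      deriv (weightQuot β W) z * sqrtGapPrimitive (potential β z / ε) := by
  have hc : Continuous fun z => sqrtGapPrimitive (potential β z / ε) :=
    continuous_sqrtGapPrimitive.comp ((continuous_potential hβ).div_const ε)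
  have hi : IntervalIntegrable
      (fun z => deriv (weightQuot β W) z * sqrtGapPrimitive (potential β z / ε)) volume 0 1 :=
    ((hW.contDiff_deriv_quot hβ).continuous.mul hc).intervalIntegrable _ _
  have key := intervalIntegral.integral_eq_sub_of_hasDerivAt_of_le zero_le_one
    (f := fun z => weightQuot β W z * sqrtGapPrimitive (potential β z / ε))
    (((hW.contDiff_quot hβ).continuous.mul hc).continuousOn) (fun z hz => ?_)
    (hi.add (intervalIntegrable_gap hβ hW.1.continuous hε))
  · rw [intervalIntegral.integral_add hi (intervalIntegrable_gap hβ hW.1.continuous hε)] at key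
    simp only [potential_zero hβ, potential_one, zero_div, sqrtGapPrimitive_zero, mul_zero,
      sub_zero] at key
    rw [gapIntegral]
    linarith
  · have hz0 := hz.1
    have hp := potential_pos (β := β) hz.1 hz.2
    refine ((hW.hasDerivAt_quot hβ z).mul ((hasDerivAt_sqrtGapPrimitive (div_pos hp hε)).comp z
      ((hasDerivAt_potential β hz.1).div_const ε))).congr_deriv ?_
    congr 1
    by_cases hz' : β - (1 + β) * z = 0
    · have : z = β / (1 + β) := by field_simp; linarith
      have hWz : W z = 0 := by rw [this]; exact hW.2.self_of_nhds
      simp [weightQuot, hWz]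
    · have h1 : 1 - z ≠ 0 := by linarith [hz.2]
      have h2 : z ^ β ≠ 0 := (rpow_pos_of_pos hz.1 β).ne'
      have h3 : β * (1 - z) - z = β - (1 + β) * z := by ring
      rw [h3, weightQuot]
      simp only [potential]
      generalize sqrtGap _ = s
      generalize hd : β - (1 + β) * z = d at *
      field_simp

lemma hasDerivAt_gapIntegral {β : ℝ} (hβ : 0 < β) {W : ℝ → ℝ} (hW : IsWeight β W) {ε : ℝ}
    (hε : 0 < ε) :
    HasDerivAt (gapIntegral β W) (gapIntegral β (weightOp β W) ε / ε) ε := by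
  have hP := (hW.contDiff_deriv_quot hβ).continuous
  have hg := continuous_potential hβ
  have hev : gapIntegral β W =ᶠ[𝓝 ε] fun ε => -∫ z in (0 : ℝ)..1,
      deriv (weightQuot β W) z * sqrtGapPrimitive (potential β z / ε) := by
    filter_upwards [Ioi_mem_nhds hε] with e he using gapIntegral_eq_neg_integral hβ hW he
  have hint : ∀ e : ℝ, Continuous fun z =>
      deriv (weightQuot β W) z * sqrtGapPrimitive (potential β z / e) := fun e =>
    hP.mul (continuous_sqrtGapPrimitive.comp (hg.div_const e))
  have hint' : Continuous fun z =>
      -(deriv (weightQuot β W) z * sqrtGap (potential β z / ε) / ε) :=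
    ((hP.mul (continuous_sqrtGap.comp (hg.div_const ε))).div_const ε).neg
  have key := (intervalIntegral.hasDerivAt_integral_of_dominated_loc_of_deriv_le
    (μ := volume) (a := 0) (b := 1)
    (F := fun e z => deriv (weightQuot β W) z * sqrtGapPrimitive (potential β z / e))
    (F' := fun e z => -(deriv (weightQuot β W) z * sqrtGap (potential β z / e) / e))
    (bound := fun z => |deriv (weightQuot β W) z| / (ε / 2))
    (Ioi_mem_nhds (half_lt_self hε))
    (Eventually.of_forall fun e => (hint e).aestronglyMeasurable)
    ((hint ε).intervalIntegrable _ _) hint'.aestronglyMeasurable ?_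
    ((hP.abs.div_const _).intervalIntegrable _ _) ?_).2
  · refine (key.neg.congr_of_eventuallyEq hev).congr_deriv ?_
    rw [intervalIntegral.integral_neg, neg_neg, intervalIntegral.integral_div, gapIntegral]
    congr 1
    refine intervalIntegral.integral_congr_ae (Eventually.of_forall fun z hz => ?_)
    rw [uIoc_of_le zero_le_one] at hz
    rw [weightOp, mul_div_cancel_left₀ _ hz.1.ne']
  · refine Eventually.of_forall fun z _ e he => ?_
    have he' : ε / 2 < e := he
    rw [norm_neg, Real.norm_eq_abs, abs_div, abs_mul, abs_of_pos (by linarith : 0 < e)]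
    have h1 := abs_sqrtGap_le_one (potential β z / e)
    gcongr
    exact mul_le_of_le_one_right (abs_nonneg _) h1
  · have hne : ∀ᵐ z : ℝ ∂volume, z ≠ 1 := compl_mem_ae_iff.2 (measure_singleton 1)
    filter_upwards [hne] with z hz1 hz e he
    rw [uIoc_of_le zero_le_one] at hz
    have he' : 0 < e := lt_trans (half_pos hε) he
    have hp := potential_pos (β := β) hz.1 (lt_of_le_of_ne hz.2 hz1)
    refine (((hasDerivAt_sqrtGapPrimitive (div_pos hp he')).comp e
      ((hasDerivAt_inv he'.ne').const_mul (potential β z))).const_mul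
        (deriv (weightQuot β W) z)).congr_deriv ?_
    have : potential β z ≠ 0 := hp.ne'
    generalize sqrtGap _ = s
    field_simp

lemma isBigO_integral_comp_potential_div {β : ℝ} (hβ2 : β < 2) {U φ : ℝ → ℝ}
    (hU : Continuous U) {C : ℝ} (hφ : ∀ r, |φ r| * √r ≤ C) :
    (fun ε => ∫ z in (0 : ℝ)..1, U z * φ (potential β z / ε)) =O[𝓝[>] 0] fun ε => √ε := by
  obtain ⟨M, hM⟩ := isCompact_Icc.exists_bound_of_continuousOn (hU.continuousOn (s := Icc 0 1))
  refine IsBigO.of_bound (M * C * ∫ z in (0 : ℝ)..1, (√(potential β z))⁻¹) ?_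
  filter_upwards [self_mem_nhdsWithin] with ε hε
  have hε : 0 < ε := hε
  rw [Real.norm_of_nonneg (Real.sqrt_nonneg ε)]
  have hne : ∀ᵐ z : ℝ ∂volume, z ≠ 1 := compl_mem_ae_iff.2 (measure_singleton 1)
  have hb := (intervalIntegrable_inv_sqrt_potential hβ2).const_mul (M * C * √ε)
  refine (intervalIntegral.norm_integral_le_of_norm_le zero_le_one ?_ hb).trans_eq ?_
  · filter_upwards [hne] with z hz1 hz
    have hp := potential_pos (β := β) hz.1 (lt_of_le_of_ne hz.2 hz1)
    have h1 := hφ (potential β z / ε)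
    have h2 := hM z ⟨hz.1.le, hz.2⟩
    have h3 := Real.sqrt_pos.2 hp
    have h4 := Real.sqrt_pos.2 hε
    rw [Real.sqrt_div' _ hε.le] at h1
    have h5 : |φ (potential β z / ε)| ≤ C * √ε * (√(potential β z))⁻¹ := by
      rw [← div_eq_mul_inv, le_div_iff₀ h3]
      rwa [mul_div_assoc', div_le_iff₀ h4] at h1
    rw [norm_mul, Real.norm_eq_abs (φ _)]
    calc ‖U z‖ * |φ (potential β z / ε)| ≤ M * (C * √ε * (√(potential β z))⁻¹) := by
          have : 0 ≤ M := (norm_nonneg _).trans h2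
          gcongr
      _ = _ := by ring
  · rw [intervalIntegral.integral_const_mul]
    ring

lemma gapIntegral_weightOp_isBigO {β : ℝ} (hβ : 0 < β) (hβ2 : β < 2) {W : ℝ → ℝ}
    (hW : IsWeight β W) : gapIntegral β (weightOp β W) =O[𝓝[>] 0] fun ε => √ε := by
  refine (isBigO_integral_comp_potential_div hβ2 (hW.contDiff_deriv_quot hβ).continuous
    abs_sqrtGap_mul_sqrt_le_one).congr_left fun ε => ?_
  rw [gapIntegral]
  refine intervalIntegral.integral_congr_ae (Eventually.of_forall fun z hz => ?_)
  rw [uIoc_of_le zero_le_one] at hz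
  rw [weightOp, mul_div_cancel_left₀ _ hz.1.ne']

lemma gapIntegral_add_isBigO {β : ℝ} (hβ : 0 < β) (hβ2 : β < 2) {W : ℝ → ℝ}
    (hW : IsWeight β W) :
    (fun ε => gapIntegral β W ε + π * W 0 / β) =O[𝓝[>] 0] fun ε => √ε := by
  have hP := (hW.contDiff_deriv_quot hβ).continuous
  refine (isBigO_integral_comp_potential_div hβ2 hP
    abs_sqrtGapPrimitive_add_pi_mul_sqrt_le).neg_left.congr' ?_ EventuallyEq.rfl
  filter_upwards [self_mem_nhdsWithin] with ε hε
  have hc : Continuous fun z => sqrtGapPrimitive (potential β z / ε) :=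
    continuous_sqrtGapPrimitive.comp ((continuous_potential hβ).div_const ε)
  have hi : IntervalIntegrable
      (fun z => deriv (weightQuot β W) z * sqrtGapPrimitive (potential β z / ε)) volume 0 1 :=
    (hP.mul hc).intervalIntegrable _ _
  have hi' : IntervalIntegrable (fun z => deriv (weightQuot β W) z * π) volume 0 1 :=
    (hP.mul continuous_const).intervalIntegrable _ _
  rw [gapIntegral_eq_neg_integral hβ hW hε]
  simp_rw [mul_add]
  rw [intervalIntegral.integral_add hi hi', intervalIntegral.integral_mul_const,
    intervalIntegral.integral_deriv_eq_sub (fun z _ => (hW.hasDerivAt_quot hβ z).differentiableAt)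
      (hP.intervalIntegrable _ _)]
  simp [weightQuot]
  ring

lemma hasDerivAt_integral_sub_rpow {a b c : ℝ} (hab : a ≤ b) {φ g : ℝ → ℝ}
    (hφ : ContinuousOn φ (Icc a b)) (hg : ContinuousOn g (Icc a b)) (hc : ∀ z ∈ Icc a b, c ≤ g z)
    (p : ℝ) {ε : ℝ} (hε : ε < c) :
    HasDerivAt (fun ε => ∫ z in a..b, φ z * (g z - ε) ^ p)
      (-p * ∫ z in a..b, φ z * (g z - ε) ^ (p - 1)) ε := by
  have hcont : ∀ (q : ℝ) {e : ℝ}, e < c →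
      ContinuousOn (fun z => φ z * (g z - e) ^ q) (Icc a b) := fun q e he =>
    hφ.mul ((hg.sub continuousOn_const).rpow_const fun z hz =>
      Or.inl (by linarith [hc z hz] : 0 < g z - e).ne')
  have hint : ∀ (q : ℝ) {e : ℝ}, e < c →
      IntervalIntegrable (fun z => φ z * (g z - e) ^ q) volume a b := fun q e he =>
    ContinuousOn.intervalIntegrable_of_Icc hab (hcont q he)
  obtain ⟨A, hA⟩ := isCompact_Icc.exists_bound_of_continuousOn hφ
  obtain ⟨G, hG⟩ := isCompact_Icc.exists_bound_of_continuousOn hg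
  have hd : 0 < (c - ε) / 2 := by linarith
  have hpow : ContinuousOn (fun y : ℝ => y ^ (p - 1)) (Icc ((c - ε) / 2) (G + 1 - ε)) :=
    continuousOn_id.rpow_const fun y hy => Or.inl (lt_of_lt_of_le hd hy.1).ne'
  obtain ⟨B, hB⟩ := isCompact_Icc.exists_bound_of_continuousOn hpow
  have hs : Ioo (ε - 1) ((c + ε) / 2) ∈ 𝓝 ε := Ioo_mem_nhds (by linarith) (by linarith)
  have key := (intervalIntegral.hasDerivAt_integral_of_dominated_loc_of_deriv_le
    (μ := volume) (a := a) (b := b) (F := fun e z => φ z * (g z - e) ^ p)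
    (F' := fun e z => -p * (φ z * (g z - e) ^ (p - 1)))
    (bound := fun _ => |p| * (A * B)) hs ?_ (hint p hε)
    ((hint (p - 1) hε).const_mul (-p)).aestronglyMeasurable_restrict_uIoc ?_
    intervalIntegrable_const ?_).2
  · rwa [intervalIntegral.integral_const_mul] at key
  · filter_upwards [Iio_mem_nhds hε] with e he
    exact (hint p he).aestronglyMeasurable_restrict_uIoc
  · refine Eventually.of_forall fun z hz e he => ?_
    rw [uIoc_of_le hab] at hz
    have hz' : z ∈ Icc a b := ⟨hz.1.le, hz.2⟩
    have h1 := hA z hz'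
    have h2 := hB (g z - e) ⟨by linarith [hc z hz', he.2],
      by linarith [he.1, (le_abs_self _).trans (hG z hz')]⟩
    rw [norm_mul, norm_mul, norm_neg, Real.norm_eq_abs p]
    have : 0 ≤ A := (norm_nonneg _).trans h1
    gcongr
  · refine Eventually.of_forall fun z hz e he => ?_
    rw [uIoc_of_le hab] at hz
    have hz' : 0 < g z - e := by linarith [hc z ⟨hz.1.le, hz.2⟩, he.2]
    refine ((((hasDerivAt_id e).const_sub (g z)).rpow_const (p := p)
      (Or.inl hz'.ne')).const_mul (φ z)).congr_deriv ?_
    simp only [id]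
    ring

lemma contDiffOn_integral_sub_rpow {a b c : ℝ} (hab : a ≤ b) {φ g : ℝ → ℝ}
    (hφ : ContinuousOn φ (Icc a b)) (hg : ContinuousOn g (Icc a b)) (hc : ∀ z ∈ Icc a b, c ≤ g z)
    (p : ℝ) : ContDiffOn ℝ ∞ (fun ε => ∫ z in a..b, φ z * (g z - ε) ^ p) (Iio c) := by
  rw [contDiffOn_infty]
  intro n
  induction n generalizing p with
  | zero =>
    exact contDiffOn_zero.2 fun ε hε =>
      (hasDerivAt_integral_sub_rpow hab hφ hg hc p hε).continuousAt.continuousWithinAt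
  | succ n ih =>
    push_cast
    rw [contDiffOn_succ_iff_deriv_of_isOpen isOpen_Iio]
    refine ⟨fun ε hε => (hasDerivAt_integral_sub_rpow hab hφ hg hc p
      hε).differentiableAt.differentiableWithinAt, by simp, ?_⟩
    exact (contDiffOn_const.mul (ih (p - 1))).congr fun ε hε =>
      (hasDerivAt_integral_sub_rpow hab hφ hg hc p hε).deriv

/-- The functions `h` that are smooth on `(-∞, c)` and vanish at `0`. -/
def SmoothVanishing (c : ℝ) (h : ℝ → ℝ) : Prop := ContDiffOn ℝ ∞ h (Iio c) ∧ h 0 = 0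

lemma SmoothVanishing.euler {c : ℝ} {h : ℝ → ℝ} (hh : SmoothVanishing c h) :
    SmoothVanishing c fun ε => ε * deriv h ε - h ε / 2 :=
  ⟨(contDiffOn_id.mul ((contDiffOn_infty_iff_deriv_of_isOpen isOpen_Iio).1 hh.1).2).sub
    (hh.1.div_const 2), by simp [hh.2]⟩

lemma SmoothVanishing.hasDerivAt {c : ℝ} {h : ℝ → ℝ} (hh : SmoothVanishing c h) {ε : ℝ}
    (h0 : 0 < ε) (hc : ε < c) :
    HasDerivAt (fun ε => h ε / √ε) ((ε * deriv h ε - h ε / 2) / √ε / ε) ε := by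
  have h1 : HasDerivAt h (deriv h ε) ε :=
    ((hh.1.differentiableOn (by simp)).differentiableAt (Iio_mem_nhds hc)).hasDerivAt
  have h2 := (Real.sqrt_pos.2 h0).ne'
  refine (h1.div (Real.hasDerivAt_sqrt h0.ne') h2).congr_deriv ?_
  have h3 := Real.sq_sqrt h0.le
  rw [div_div, div_eq_div_iff (pow_ne_zero 2 h2) (mul_ne_zero h2 h0.ne')]
  generalize √ε = s at *
  subst h3
  field_simp

lemma SmoothVanishing.isBigO {c : ℝ} (hc : 0 < c) {h : ℝ → ℝ} (hh : SmoothVanishing c h) :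
    (fun ε => h ε / √ε) =O[𝓝[>] 0] fun ε => √ε := by
  have h1 := ((hh.1.differentiableOn (by simp)).differentiableAt (Iio_mem_nhds hc)).isBigO_sub
  simp only [hh.2, sub_zero] at h1
  refine ((h1.mono nhdsWithin_le_nhds).mul (isBigO_refl (fun ε : ℝ => (√ε)⁻¹) _)).congr'
    (Eventually.of_forall fun ε => (div_eq_mul_inv _ _).symm) ?_
  filter_upwards [self_mem_nhdsWithin] with ε hε
  have h2 := (Real.sqrt_pos.2 hε).ne'
  have h3 := Real.mul_self_sqrt (le_of_lt (mem_Ioi.1 hε))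
  rw [mul_inv_eq_iff_eq_mul₀ h2, h3]

/-- The part of the gap integral localised near the critical point is, up to the factor
`ε ^ (-1/2)`, a smooth function of `ε`. -/
lemma exists_smoothVanishing_gapIntegral {β : ℝ} (hβ : 0 < β) {W : ℝ → ℝ} (hW : Continuous W)
    {a b : ℝ} (ha : 0 < a) (hab : a ≤ b) (hb : b < 1) (hWa : ∀ z ≤ a, W z = 0)
    (hWb : ∀ z, b ≤ z → W z = 0) :
    ∃ c > 0, ∃ h, SmoothVanishing c h ∧ gapIntegral β W =ᶠ[𝓝[>] 0] fun ε => h ε / √ε := by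
  have hg := (continuous_potential hβ).continuousOn (s := Icc a b)
  obtain ⟨z₀, hz₀, hmin⟩ := isCompact_Icc.exists_isMinOn (nonempty_Icc.2 hab) hg
  have hc : 0 < potential β z₀ :=
    potential_pos (lt_of_lt_of_le ha hz₀.1) (lt_of_le_of_lt hz₀.2 hb)
  have hφ : ContinuousOn (fun z => W z / z) (Icc a b) :=
    hW.continuousOn.div continuousOn_id fun z hz => (lt_of_lt_of_le ha hz.1).ne'
  have hM := contDiffOn_integral_sub_rpow hab hφ hg (fun z hz => hmin hz) (1 / 2)
  refine ⟨potential β z₀, hc, _, ⟨hM.sub (contDiffOn_const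
    (c := ∫ z in a..b, W z / z * (potential β z - 0) ^ (1 / 2 : ℝ))), sub_self _⟩, ?_⟩
  filter_upwards [self_mem_nhdsWithin, Ioo_mem_nhdsGT hc] with ε hε hε'
  have hε : 0 < ε := hε
  have hi := intervalIntegrable_gap hβ hW hε
  have hia : ∫ z in (0 : ℝ)..a, W z / z * sqrtGap (potential β z / ε) = 0 := by
    refine intervalIntegral.integral_zero_ae (Eventually.of_forall fun z hz => ?_)
    rw [uIoc_of_le ha.le] at hz
    simp [hWa z hz.2]
  have hib : ∫ z in b..1, W z / z * sqrtGap (potential β z / ε) = 0 := by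
    refine intervalIntegral.integral_zero_ae (Eventually.of_forall fun z hz => ?_)
    rw [uIoc_of_le hb.le] at hz
    simp [hWb z hz.1.le]
  have hsub : ∀ {x y : ℝ}, 0 ≤ x → x ≤ y → y ≤ 1 → IntervalIntegrable
      (fun z => W z / z * sqrtGap (potential β z / ε)) volume x y := fun {x y} hx hxy hy =>
    hi.mono_set (by
      rw [uIcc_of_le hxy, uIcc_of_le zero_le_one]
      exact Icc_subset_Icc hx hy)
  have hint : ∀ {e : ℝ}, e < potential β z₀ → IntervalIntegrable
      (fun z => W z / z * (potential β z - e) ^ (1 / 2 : ℝ)) volume a b := fun {e} he =>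
    ContinuousOn.intervalIntegrable_of_Icc hab (hφ.mul
      ((hg.sub continuousOn_const).rpow_const fun z hz => Or.inr (by norm_num)))
  rw [gapIntegral, ← intervalIntegral.integral_add_adjacent_intervals
    (hsub le_rfl ha.le (hab.trans hb.le)) (hsub ha.le (hab.trans hb.le) le_rfl),
    ← intervalIntegral.integral_add_adjacent_intervals (hsub ha.le hab hb.le)
      (hsub (ha.le.trans hab) hb.le le_rfl), hia, hib, zero_add, add_zero,
    ← intervalIntegral.integral_sub (hint hε'.2) (hint hc), ← intervalIntegral.integral_div]
  refine intervalIntegral.integral_congr_ae (Eventually.of_forall fun z hz => ?_)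
  rw [uIoc_of_le hab] at hz
  have h2 := (Real.sqrt_pos.2 hε).ne'
  have h3 : potential β z / ε - 1 = (potential β z - ε) / ε := by field_simp
  rw [sqrtGap, h3, Real.sqrt_div' _ hε.le, Real.sqrt_div' _ hε.le, ← Real.sqrt_eq_rpow,
    ← Real.sqrt_eq_rpow, sub_zero]
  ring

/-- The Euler derivatives of the full gap integral at `0`. -/
lemma exists_eulerDerivatives_gapIntegral {β : ℝ} (hβ : 0 < β) (hβ1 : β < 1) :
    ∃ F : ℕ → ℝ → ℝ, gapIntegral β (fun _ => 1) =ᶠ[𝓝[>] 0] F 0 ∧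
      (∀ n, ∀ᶠ ε in 𝓝[>] 0, HasDerivAt (F n) (F (n + 1) ε / ε) ε) ∧
      (fun ε => F 0 ε + π / β) =O[𝓝[>] 0] (fun ε => √ε) ∧
      ∀ n, F (n + 1) =O[𝓝[>] 0] fun ε => √ε := by
  set zc := β / (1 + β) with hzc
  have hzc0 : 0 < zc := by positivity
  have hzc1 : zc < 1 / 2 := by rw [hzc, div_lt_div_iff₀ (by positivity) (by norm_num)]; linarith
  let χ : ContDiffBump zc := ⟨zc / 4, zc / 2, by positivity, by linarith⟩
  have hχ : ContDiff ℝ ∞ χ := χ.contDiff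
  have hχ0 : ∀ z, zc / 2 ≤ |z - zc| → χ z = 0 := fun z hz =>
    χ.zero_of_le_dist (by rwa [Real.dist_eq])
  have hW : IsWeight β fun z => 1 - χ z := by
    refine ⟨contDiff_const.sub hχ, ?_⟩
    filter_upwards [χ.eventuallyEq_one] with z hz
    simp [hz]
  have hW' : ∀ n, IsWeight β ((weightOp β)^[n] fun z => 1 - χ z) := fun n => by
    induction n with
    | zero => exact hW
    | succ n ih => rw [Function.iterate_succ_apply']; exact ih.weightOp hβ
  obtain ⟨c, hc, h, hh, hgap⟩ := exists_smoothVanishing_gapIntegral hβ hχ.continuous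
    (a := zc / 2) (b := 3 * zc / 2) (by positivity) (by linarith) (by linarith)
    (fun z hz => hχ0 z (by rw [abs_of_nonpos] <;> linarith))
    (fun z hz => hχ0 z (by rw [abs_of_nonneg] <;> linarith))
  let E : (ℝ → ℝ) → ℝ → ℝ := fun h ε => ε * deriv h ε - h ε / 2
  have hE : ∀ n, SmoothVanishing c (E^[n] h) := fun n => by
    induction n with
    | zero => exact hh
    | succ n ih => rw [Function.iterate_succ_apply']; exact ih.euler
  refine ⟨fun n ε => gapIntegral β ((weightOp β)^[n] fun z => 1 - χ z) ε + (E^[n] h) ε / √ε,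
    ?_, fun n => ?_, ?_, fun n => ?_⟩
  · filter_upwards [self_mem_nhdsWithin, hgap] with ε hε he
    have hi := intervalIntegrable_gap hβ hW.1.continuous hε
    have hi' := intervalIntegrable_gap hβ hχ.continuous hε
    simp only [Function.iterate_zero, id]
    rw [← he, gapIntegral, gapIntegral, gapIntegral, ← intervalIntegral.integral_add hi hi']
    congr 1
    ext z
    ring
  · filter_upwards [self_mem_nhdsWithin, Ioo_mem_nhdsGT hc] with ε hε hε'
    refine ((hasDerivAt_gapIntegral hβ (hW' n) hε).add
      ((hE n).hasDerivAt hε hε'.2)).congr_deriv ?_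
    simp only [Function.iterate_succ_apply', E]
    ring
  · have h1 := gapIntegral_add_isBigO hβ (by linarith) hW
    rw [hχ0 0 (by rw [abs_of_nonpos] <;> linarith)] at h1
    refine (h1.add (hh.isBigO hc)).congr_left fun ε => ?_
    simp only [Function.iterate_zero, id]
    ring
  · refine IsBigO.add ?_ ((hE (n + 1)).isBigO hc)
    simp only [Function.iterate_succ_apply']
    exact gapIntegral_weightOp_isBigO hβ (by linarith) (hW' n)

lemma continuous_Vfun {α : ℝ} (hα : 1 < α) (x : ℝ) : Continuous (Vfun α x) := by
  unfold Vfun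
  have : Continuous fun u : ℝ => u ^ (2 * α + 2) :=
    continuous_id.rpow_const fun _ => Or.inr (by linarith)
  fun_prop

lemma Vfun_neg_of_le {α x u : ℝ} (hα : 1 < α) (hx : 2 ≤ x) (hu : x ≤ u) : Vfun α x u < 0 := by
  have h0 : 0 < u := by linarith
  have h1 : x ≤ u ^ (2 * α) := by
    have h := rpow_le_rpow_of_exponent_le (show (1 : ℝ) ≤ u by linarith)
      (show (1 : ℝ) ≤ 2 * α by linarith)
    rw [rpow_one] at h
    exact hu.trans h
  have h2 : u ^ (2 * α + 2) = u ^ (2 * α) * u ^ 2 := by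
    rw [rpow_add h0]; norm_cast
  rw [Vfun, h2]
  nlinarith [mul_nonneg (sub_nonneg.2 h1) (sq_nonneg u)]

lemma integral_sqrt_Vfun_eq_Ioi {α x : ℝ} (hα : 1 < α) (hx : 2 < x) :
    ∫ u in u1F α x..u2F α x, √(Vfun α x u) / u = ∫ u in Ioi (0 : ℝ), √(Vfun α x u) / u := by
  set R := {u : ℝ | 0 < u ∧ Vfun α x u = 0} with hR
  have hc := continuous_Vfun hα x
  have hV0 : Vfun α x 0 < 0 := by
    simp [Vfun, Real.zero_rpow (by linarith : 2 * α + 2 ≠ 0)]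
  have hV1 : 0 < Vfun α x 1 := by simp [Vfun]; linarith
  have hbelow : BddBelow R := ⟨0, fun u hu => hu.1.le⟩
  have habove : BddAbove R := ⟨x, fun u hu => by
    by_contra! h
    exact (Vfun_neg_of_le hα hx.le h.le).ne hu.2⟩
  have hleft : ∀ {u}, 0 < u → 0 < Vfun α x u → ∃ r ∈ R, r < u := fun {u} hu hV => by
    obtain ⟨r, hr, hr'⟩ := intermediate_value_Ioo hu.le hc.continuousOn ⟨hV0, hV⟩
    exact ⟨r, ⟨hr.1, hr'⟩, hr.2⟩
  have hright : ∀ {u}, 0 < u → 0 < Vfun α x u → ∃ r ∈ R, u < r := fun {u} hu hV => by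
    have hux : u < x := by
      by_contra! h
      exact (Vfun_neg_of_le hα hx.le h).not_gt hV
    obtain ⟨r, hr, hr'⟩ := intermediate_value_Ioo' hux.le hc.continuousOn
      ⟨Vfun_neg_of_le hα hx.le le_rfl, hV⟩
    exact ⟨r, ⟨hu.trans hr.1, hr'⟩, hr.1⟩
  obtain ⟨r, hr, -⟩ := hleft one_pos hV1
  have h12 : u1F α x ≤ u2F α x := csInf_le_csSup ⟨r, hr⟩ hbelow habove
  have h1 : 0 ≤ u1F α x := Real.sInf_nonneg fun u hu => hu.1.le
  rw [intervalIntegral.integral_of_le h12]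
  symm
  refine setIntegral_eq_of_subset_of_forall_sdiff_eq_zero measurableSet_Ioi
    (fun u hu => lt_of_le_of_lt h1 hu.1) fun u hu => ?_
  have hu0 : 0 < u := hu.1
  rw [Real.sqrt_eq_zero_of_nonpos, zero_div]
  by_contra! hV
  obtain ⟨r, hr, hru⟩ := hleft hu0 hV
  obtain ⟨s, hs, hus⟩ := hright hu0 hV
  exact hu.2 ⟨lt_of_le_of_lt (csInf_le hbelow hr) hru, hus.le.trans (le_csSup habove hs)⟩

lemma Vfun_rpow {α x z : ℝ} (hα : 0 < α) (hx : 0 < x) (hz : 0 < z) :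
    Vfun α x ((x * z) ^ (1 / (2 * α))) = potential (1 / α) z / x ^ (-(1 + 1 / α)) - 1 := by
  have hxz : 0 < x * z := mul_pos hx hz
  have h1 : ((x * z) ^ (1 / (2 * α))) ^ 2 = x ^ (1 / α) * z ^ (1 / α) := by
    rw [← rpow_natCast, ← rpow_mul hxz.le, ← mul_rpow hx.le hz.le]
    congr 1
    push_cast
    field_simp
  have h2 : ((x * z) ^ (1 / (2 * α))) ^ (2 * α + 2) = x * z * (x ^ (1 / α) * z ^ (1 / α)) := by
    rw [← rpow_mul hxz.le, ← mul_rpow hx.le hz.le,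
      show 1 / (2 * α) * (2 * α + 2) = 1 + 1 / α by field_simp, rpow_add hxz, rpow_one]
  rw [Vfun, h1, h2, potential, rpow_neg hx.le, rpow_add hx, rpow_one]
  field_simp

lemma integral_Ioi_sqrt_Vfun {α x : ℝ} (hα : 0 < α) (hx : 0 < x) :
    ∫ u in Ioi (0 : ℝ), √(Vfun α x u) / u = 1 / (2 * α) *
      ∫ z in (0 : ℝ)..1, √(potential (1 / α) z / x ^ (-(1 + 1 / α)) - 1) / z := by
  have hp : 0 < 1 / (2 * α) := by positivity
  have h := integral_comp_mul_left_Ioi (fun w : ℝ =>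
    (1 / (2 * α) * w ^ (1 / (2 * α) - 1)) • (√(Vfun α x (w ^ (1 / (2 * α)))) / w ^ (1 / (2 * α))))
    0 hx
  rw [mul_zero, integral_comp_rpow_Ioi_of_pos (g := fun u => √(Vfun α x u) / u) hp,
    smul_eq_mul, eq_inv_mul_iff_mul_eq₀ hx.ne', ← integral_const_mul] at h
  rw [← h, intervalIntegral.integral_of_le zero_le_one, ← integral_const_mul]
  have hsub : ∫ z in Ioi (0 : ℝ), 1 / (2 * α) *
        (√(potential (1 / α) z / x ^ (-(1 + 1 / α)) - 1) / z) =
      ∫ z in Ioc (0 : ℝ) 1, 1 / (2 * α) *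
        (√(potential (1 / α) z / x ^ (-(1 + 1 / α)) - 1) / z) := by
    refine setIntegral_eq_of_subset_of_forall_sdiff_eq_zero measurableSet_Ioi
      (fun z hz => hz.1) fun z hz => ?_
    have hz0 : 0 < z := hz.1
    have hz1 : 1 < z := by
      by_contra! h
      exact hz.2 ⟨hz0, h⟩
    have hpot : potential (1 / α) z / x ^ (-(1 + 1 / α)) ≤ 0 :=
      div_nonpos_of_nonpos_of_nonneg
        (mul_nonpos_of_nonneg_of_nonpos (by positivity) (by linarith)) (by positivity)
    rw [Real.sqrt_eq_zero_of_nonpos (by linarith), zero_div, mul_zero]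
  rw [← hsub]
  refine setIntegral_congr_fun measurableSet_Ioi fun z hz => ?_
  have hz0 : 0 < z := hz
  have hxz : 0 < x * z := mul_pos hx hz0
  have hne := (rpow_pos_of_pos hxz (1 / (2 * α))).ne'
  simp only [Vfun_rpow hα hx hz0, smul_eq_mul]
  rw [rpow_sub_one hxz.ne']
  field_simp

lemma Sfun_eq_gapIntegral {α x : ℝ} (hα : 1 < α) (hx : 2 < x) (hρ : rhoC α < x) :
    Sfun α x = 1 / (2 * π * α) *
      (ProbabilityTheory.beta (1 / (2 * α)) (3 / 2) / √(x ^ (-(1 + 1 / α))) +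
        gapIntegral (1 / α) (fun _ => 1) (x ^ (-(1 + 1 / α)))) := by
  have hα0 : 0 < α := by linarith
  have hx0 : 0 < x := by linarith
  have hβ : 0 < 1 / α := by positivity
  rw [Sfun, if_pos hρ, integral_sqrt_Vfun_eq_Ioi hα hx, integral_Ioi_sqrt_Vfun hα0 hx0]
  set ε := x ^ (-(1 + 1 / α)) with hεdef
  have hε : 0 < ε := rpow_pos_of_pos hx0 _
  have h1 : ∫ z in (0 : ℝ)..1, √(potential (1 / α) z / ε - 1) / z =
      (∫ z in (0 : ℝ)..1, √(potential (1 / α) z) / z / √ε) +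
        gapIntegral (1 / α) (fun _ => 1) ε := by
    rw [gapIntegral, ← intervalIntegral.integral_add
      ((intervalIntegrable_sqrt_potential_div hβ).div_const _)
      (intervalIntegrable_gap hβ continuous_const hε)]
    congr 1
    ext z
    rw [sqrtGap, Real.sqrt_div' _ hε.le]
    ring
  rw [h1, intervalIntegral.integral_div, integral_sqrt_potential_div hβ,
    show 1 / α / 2 = 1 / (2 * α) by field_simp]
  ring

lemma rhoC_pos {α : ℝ} (hα : 0 < α) : 0 < rhoC α := by unfold rhoC; positivity

lemma Aconst_pos {α : ℝ} (hα : 0 < α) : 0 < Aconst α := by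
  have h1 := Real.Gamma_pos_of_pos (show 0 < 1 / (2 * α) by positivity)
  have h2 := Real.Gamma_pos_of_pos (show 0 < (1 + α) / (2 * α) by positivity)
  unfold Aconst
  positivity

/-- The leading coefficient in closed form. -/
lemma leading_coefficient {α : ℝ} (hα : 0 < α) :
    (1 + α) / (π * α) * ProbabilityTheory.beta (1 / (2 * α)) (3 / 2) *
      rhoC α ^ ((1 + α) / (2 * α)) = Aconst α ^ ((1 + α) / (2 * α)) := by
  have h1 := Real.Gamma_pos_of_pos (show 0 < 1 / (2 * α) by positivity)
  have h2 := Real.Gamma_pos_of_pos (show 0 < (1 + α) / (2 * α) by positivity)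
  have h3 : Real.Gamma (3 / 2) = √π / 2 := by
    rw [show (3 / 2 : ℝ) = 1 / 2 + 1 by norm_num, Real.Gamma_add_one (by norm_num),
      Real.Gamma_one_half_eq]
    ring
  have h4 : Real.Gamma (1 / (2 * α) + 3 / 2) =
      (1 + α) / (2 * α) * Real.Gamma ((1 + α) / (2 * α)) := by
    rw [← Real.Gamma_add_one (by positivity)]
    congr 1
    field_simp
    ring
  have h5 : rhoC α ^ ((1 + α) / (2 * α)) = (1 + α) ^ ((1 + α) / (2 * α)) / √α := by
    have e1 : α ^ ((1 + α) / (2 * α)) = α ^ (1 / (2 * α)) * √α := by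
      rw [Real.sqrt_eq_rpow, ← rpow_add hα]
      congr 1
      field_simp
    have e2 : 0 < √α := Real.sqrt_pos.2 hα
    have e3 : 0 < α ^ (1 / (2 * α)) := by positivity
    rw [rhoC, mul_rpow (by positivity) (by positivity), div_rpow (by positivity) hα.le,
      ← rpow_mul hα.le, show 1 / (α + 1) * ((1 + α) / (2 * α)) = 1 / (2 * α) by
        field_simp; ring, e1, add_comm α 1]
    field_simp
  have h6 : Aconst α ^ ((1 + α) / (2 * α)) = (1 + α) ^ ((1 + α) / (2 * α)) *
      (Real.Gamma (1 / (2 * α)) / (√(π * α) * Real.Gamma ((1 + α) / (2 * α)))) := by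
    rw [Aconst, mul_rpow (by positivity) (by positivity), ← rpow_mul (by positivity),
      show 2 * α / (α + 1) * ((1 + α) / (2 * α)) = 1 by field_simp; ring, rpow_one]
  rw [h5, h6, ProbabilityTheory.beta, h3, h4, Real.sqrt_mul Real.pi_pos.le]
  have hs : √π ≠ 0 := (Real.sqrt_pos.2 Real.pi_pos).ne'
  have hs' : √α ≠ 0 := (Real.sqrt_pos.2 hα).ne'
  have hp := Real.sq_sqrt Real.pi_pos.le
  have hpi := Real.pi_ne_zero
  generalize (1 + α) ^ ((1 + α) / (2 * α)) = y
  field_simp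
  linear_combination y * hp

lemma eulerD_iterate_eventuallyEq {f : ℝ → ℝ} {T : ℕ → ℝ → ℝ} (h0 : f =ᶠ[atTop] T 0)
    (hT : ∀ n, ∀ᶠ ξ in atTop, HasDerivAt (T n) (T (n + 1) ξ / ξ) ξ) (n : ℕ) :
    eulerD^[n] f =ᶠ[atTop] T n := by
  induction n with
  | zero => exact h0
  | succ n ih =>
    rw [Function.iterate_succ_apply']
    obtain ⟨a, ha⟩ := eventually_atTop.1 ih
    filter_upwards [hT n, eventually_gt_atTop a, eventually_gt_atTop 0] with ξ h1 h2 h3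
    have : eulerD^[n] f =ᶠ[𝓝 ξ] T n := by
      filter_upwards [Ioi_mem_nhds h2] with y hy using ha y (le_of_lt hy)
    rw [eulerD, this.deriv_eq, h1.deriv, mul_div_cancel₀ _ h3.ne']

/-- Asymptotic expansion of `τ` and all its Euler derivatives, from those of the gap integral. -/
lemma exists_eulerDerivatives_tauF {α : ℝ} (hα : 1 < α) :
    ∃ G : ℕ → ℝ → ℝ,
      (∀ n, eulerD^[n] (tauF α) =ᶠ[atTop] fun ξ =>
        ((1 + α) / (2 * α)) ^ n * (Aconst α * ξ) ^ ((1 + α) / (2 * α)) + G n ξ) ∧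
      (fun ξ => G 0 ξ + (1 + α)) =O[atTop] (fun ξ => ξ ^ (-((1 + α) / (2 * α)))) ∧
      ∀ n, G (n + 1) =O[atTop] fun ξ => ξ ^ (-((1 + α) / (2 * α))) := by
  have hα0 : 0 < α := by linarith
  have hβ1 : 1 / α < 1 := by rw [div_lt_one hα0]; exact hα
  obtain ⟨F, hF0, hFd, hFO, hFOn⟩ := exists_eulerDerivatives_gapIntegral (β := 1 / α)
    (by positivity) hβ1
  have hlead := leading_coefficient hα0
  set γ := (1 + α) / (2 * α) with hγ
  have hγ0 : 0 < γ := by positivity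
  have hγ2 : 1 + 1 / α = 2 * γ := by rw [hγ]; field_simp; ring
  have hρ := rhoC_pos hα0
  have hA := Aconst_pos hα0
  set C := (1 + α) / (π * α) with hC
  set ρ := rhoC α with hρdef
  let e : ℝ → ℝ := fun ξ => (ρ * ξ) ^ (-(2 * γ))
  have hmul : Tendsto (fun ξ => ρ * ξ) atTop atTop := tendsto_id.const_mul_atTop hρ
  have he : Tendsto e atTop (𝓝[>] 0) := by
    refine tendsto_nhdsWithin_iff.2
      ⟨(tendsto_rpow_neg_atTop (by positivity : 0 < 2 * γ)).comp hmul, ?_⟩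
    filter_upwards [eventually_gt_atTop 0] with ξ hξ
    exact rpow_pos_of_pos (mul_pos hρ hξ) _
  have hsqrt : ∀ {ξ : ℝ}, 0 < ξ → √(e ξ) = (ρ * ξ) ^ (-γ) := fun {ξ} hξ => by
    rw [Real.sqrt_eq_rpow, ← rpow_mul (mul_pos hρ hξ).le]
    congr 1
    ring
  have hO : ∀ {f : ℝ → ℝ}, f =O[𝓝[>] 0] (fun ε => √ε) →
      (fun ξ => f (e ξ)) =O[atTop] fun ξ => ξ ^ (-γ) := fun {f} hf => by
    refine (hf.comp_tendsto he).trans ?_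
    refine ((isBigO_refl (fun ξ : ℝ => ξ ^ (-γ)) atTop).const_mul_left (ρ ^ (-γ))).congr' ?_
      EventuallyEq.rfl
    filter_upwards [eventually_gt_atTop 0] with ξ hξ
    rw [Function.comp, hsqrt hξ, mul_rpow hρ.le hξ.le]
  have hpow : ∀ {ξ : ℝ}, 0 < ξ → ∀ p : ℝ,
      HasDerivAt (fun ξ => (ρ * ξ) ^ p) (p * (ρ * ξ) ^ p / ξ) ξ := fun {ξ} hξ p => by
    refine (((hasDerivAt_id ξ).const_mul ρ).rpow_const (p := p)
      (Or.inl (mul_pos hρ hξ).ne')).congr_deriv ?_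
    simp only [id]
    rw [rpow_sub_one (mul_pos hρ hξ).ne']
    field_simp
  have hAξ : ∀ {ξ : ℝ}, 0 < ξ → C * ProbabilityTheory.beta (1 / (2 * α)) (3 / 2) *
      (ρ * ξ) ^ γ = (Aconst α * ξ) ^ γ := fun {ξ} hξ => by
    rw [mul_rpow hρ.le hξ.le, mul_rpow hA.le hξ.le, ← hlead]
    ring
  set B := ProbabilityTheory.beta (1 / (2 * α)) (3 / 2)
  let T : ℕ → ℝ → ℝ := fun n ξ => γ ^ n * (C * B * (ρ * ξ) ^ γ) +
    C * (-(2 * γ)) ^ n * F n (e ξ)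
  have hT0 : tauF α =ᶠ[atTop] T 0 := by
    filter_upwards [eventually_gt_atTop 0, hmul.eventually_gt_atTop 2,
      hmul.eventually_gt_atTop ρ, he.eventually hF0] with ξ h0 h2 h3 h4
    have h5 := hsqrt h0
    have h6 : 0 < (ρ * ξ) ^ γ := rpow_pos_of_pos (mul_pos hρ h0) _
    simp only [e] at h4 h5
    rw [tauF, Sfun_eq_gapIntegral hα h2 h3, hγ2, h4, h5, rpow_neg (mul_pos hρ h0).le]
    simp only [T, e, hC, B]
    have := Real.pi_ne_zero
    field_simp
  have hTd : ∀ n, ∀ᶠ ξ in atTop, HasDerivAt (T n) (T (n + 1) ξ / ξ) ξ := fun n => by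
    filter_upwards [eventually_gt_atTop 0, he.eventually (hFd n)] with ξ h0 h1
    have h2 : e ξ ≠ 0 := (rpow_pos_of_pos (mul_pos hρ h0) _).ne'
    refine ((((hpow h0 γ).const_mul (C * B)).const_mul (γ ^ n)).add
      ((h1.comp ξ (hpow h0 (-(2 * γ)))).const_mul (C * (-(2 * γ)) ^ n))).congr_deriv ?_
    change _ + C * (-(2 * γ)) ^ n * (F (n + 1) (e ξ) / e ξ * (-(2 * γ) * e ξ / ξ)) = _
    simp only [T]
    field_simp
    ring
  refine ⟨fun n ξ => C * (-(2 * γ)) ^ n * F n (e ξ), fun n => ?_, ?_, fun n => ?_⟩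
  · refine (eulerD_iterate_eventuallyEq hT0 hTd n).trans ?_
    filter_upwards [eventually_gt_atTop 0] with ξ h0
    simp only [T, hAξ h0]
  · refine ((hO hFO).const_mul_left C).congr_left fun ξ => ?_
    have := Real.pi_ne_zero
    simp only [hC]
    field_simp
  · exact (hO (hFOn n)).const_mul_left _

theorem statement7 (α : ℝ) (hα : 1 < α) :
    -- τ(ξ) = (Aξ)^{(1+α)/(2α)} − (1+α) + O(ξ^{−(1+α)/(2α)}) as ξ → ∞
    ((fun ξ => tauF α ξ - ((Aconst α * ξ) ^ ((1 + α) / (2 * α)) - (1 + α)))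
      =O[atTop] fun ξ : ℝ => ξ ^ (-((1 + α) / (2 * α)))) ∧
    -- Dⁿτ(ξ) = ((1+α)/(2α))ⁿ (Aξ)^{(1+α)/(2α)} + O(ξ^{−(1+α)/(2α)}) for all n ≥ 1
    (∀ n : ℕ, 1 ≤ n →
      (fun ξ => (eulerD)^[n] (tauF α) ξ -
          ((1 + α) / (2 * α)) ^ n * (Aconst α * ξ) ^ ((1 + α) / (2 * α)))
        =O[atTop] fun ξ : ℝ => ξ ^ (-((1 + α) / (2 * α)))) := by
  obtain ⟨G, hG, hG0, hGn⟩ := exists_eulerDerivatives_tauF hα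
  refine ⟨hG0.congr' ?_ EventuallyEq.rfl, fun n hn => ?_⟩
  · filter_upwards [hG 0] with ξ hξ
    simp only [Function.iterate_zero, id, pow_zero, one_mul] at hξ
    rw [hξ]
    ring
  · obtain ⟨m, rfl⟩ := Nat.exists_eq_add_of_le' hn
    refine (hGn m).congr' ?_ EventuallyEq.rfl
    filter_upwards [hG (m + 1)] with ξ hξ
    rw [hξ]
    ring
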